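/- Null-vector equation for the two-point partition function with charges (a,−a), excursion-reflected boundary condition: fix κ > 0. For r > 0 and x ∈ (0,2π), define Z_*(r,x) := Θ′(r,0)^{2/κ} · Θ(r,x)^{−2/κ} (real powers of positive reals). Then ∂_r Z_* = (κ/2)·∂_x² Z_* + H(r,x)·∂_x Z_* + (1/2 − 1/κ)·H′(r,x)·Z_* − (6/κ)·(ζ_r(π)/π)·Z_* on (0,∞) × (0,2π). -/

import Mathlib

open Complex

/-- The theta function Θ(r,z) = (1/i)·∑_{n∈ℤ} (−1)^n e^{−r(n+1/2)²} e^{(n+1/2)iz}. -/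
noncomputable def Theta (r : ℝ) (z : ℂ) : ℂ :=
  (1 / Complex.I) * ∑' n : ℤ, (-1 : ℂ) ^ n *
    Complex.exp (-(r : ℂ) * ((n : ℂ) + 1 / 2) ^ 2) *
    Complex.exp (((n : ℂ) + 1 / 2) * Complex.I * z)

/-- The Loewner kernel H(r,z) = 2 Θ′(r,z)/Θ(r,z). -/
noncomputable def Hker (r : ℝ) (z : ℂ) : ℂ := 2 * deriv (Theta r) z / Theta r z

/-- The lattice L_r = 2πℤ + 2irℤ. -/
def ThetaLattice (r : ℝ) : Set ℂ :=
  {z | ∃ m n : ℤ, z = 2 * (Real.pi : ℂ) * m + 2 * Complex.I * r * n}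

/-- Lattice point 2πm + 2irn. -/
noncomputable def latPt (r : ℝ) (p : ℤ × ℤ) : ℂ :=
  2 * (Real.pi : ℂ) * p.1 + 2 * Complex.I * (r : ℂ) * p.2

/-- The Weierstrass zeta function with periods (2π, 2ir). -/
noncomputable def wzeta (r : ℝ) (z : ℂ) : ℂ :=
  1 / z + ∑' p : ℤ × ℤ, if p = 0 then 0 else
    (1 / (z - latPt r p) + 1 / latPt r p + z / latPt r p ^ 2)

/-- The two-point partition function with charges (a,−a),
excursion-reflected boundary condition: Z_*(r,x) = Θ′(r,0)^{2/κ} Θ(r,x)^{−2/κ}. -/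
noncomputable def Zstar (κ r x : ℝ) : ℝ :=
  ((deriv (Theta r) 0).re) ^ ((2 : ℝ) / κ) *
  ((Theta r (x : ℂ)).re) ^ (-((2 : ℝ) / κ))

/-- The termwise `k`-th derivative of theta. -/
noncomputable def tkTerm (k : ℕ) (r : ℝ) (z : ℂ) (n : ℤ) : ℂ :=
  (-1 : ℂ) ^ n * Complex.exp (-(r : ℂ) * ((n : ℂ) + 1 / 2) ^ 2) *
    ((((n : ℂ) + 1 / 2) * Complex.I) ^ k * Complex.exp (((n : ℂ) + 1 / 2) * Complex.I * z))

noncomputable def Tk (k : ℕ) (r : ℝ) (z : ℂ) : ℂ := (1 / Complex.I) * ∑' n : ℤ, tkTerm k r z n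

lemma Theta_eq_Tk (r : ℝ) : Theta r = Tk 0 r := by
  funext z
  simp [Theta, Tk, tkTerm]

lemma norm_tkTerm (k : ℕ) (r : ℝ) (z : ℂ) (n : ℤ) :
    ‖tkTerm k r z n‖ = |(n : ℝ) + 1 / 2| ^ k *
      Real.exp (-r * ((n : ℝ) + 1 / 2) ^ 2 - ((n : ℝ) + 1 / 2) * z.im) := by
  have e1 : ((n : ℂ) + 1 / 2) = (((n : ℝ) + 1 / 2 : ℝ) : ℂ) := by push_cast; ring
  unfold tkTerm
  rw [e1]
  generalize (n : ℝ) + 1 / 2 = y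
  rw [norm_mul, norm_mul, norm_mul, norm_pow, norm_mul, Complex.norm_I, Complex.norm_exp,
    Complex.norm_exp, norm_zpow, norm_neg, norm_one, one_zpow, one_mul, mul_one, Complex.norm_real,
    Real.norm_eq_abs, mul_left_comm, ← Real.exp_add]
  congr 2
  have h1 : (-(r : ℂ) * (y : ℂ) ^ 2).re = -r * y ^ 2 := by
    rw [show (-(r : ℂ) * (y : ℂ) ^ 2) = ((-r * y ^ 2 : ℝ) : ℂ) by push_cast; ring, Complex.ofReal_re]
  have h2 : ((y : ℂ) * Complex.I * z).re = - (y * z.im) := by simp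
  rw [h1, h2]; ring

noncomputable def tkBound (k : ℕ) (ρ M : ℝ) (n : ℤ) : ℝ :=
  |(n : ℝ) + 1 / 2| ^ k *
      Real.exp (-ρ * ((n : ℝ) + 1 / 2) ^ 2 + |(n : ℝ) + 1 / 2| * M)

lemma norm_tkTerm_le (k : ℕ) {ρ r M : ℝ} (hr : ρ ≤ r) {z : ℂ} (hz : |z.im| ≤ M) (n : ℤ) :
    ‖tkTerm k r z n‖ ≤ tkBound k ρ M n := by
  rw [norm_tkTerm, tkBound]
  generalize (n : ℝ) + 1 / 2 = y
  gcongr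
  have h1 : -(y * z.im) ≤ |y| * |z.im| := by rw [← abs_mul]; exact neg_le_abs _
  have h2 : |y| * |z.im| ≤ |y| * M := by gcongr
  have h3 : ρ * y ^ 2 ≤ r * y ^ 2 := by gcongr
  linarith

lemma summable_exp_neg_abs : Summable (fun n : ℤ => Real.exp (-|(n : ℝ)|)) := by
  have h : Summable (fun n : ℕ => Real.exp (-(n : ℝ))) := Real.summable_exp_neg_nat
  refine Summable.of_nat_of_neg ?_ ?_
  · simpa using h
  · simpa using h

lemma summable_tkBound (k : ℕ) {ρ : ℝ} (hρ : 0 < ρ) (M : ℝ) : Summable (tkBound k ρ M) := by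
  refine Summable.of_nonneg_of_le (fun n => by unfold tkBound; positivity) (fun n => ?_)
    (summable_exp_neg_abs.mul_left ((k.factorial : ℝ) * Real.exp ((M + 2) ^ 2 / (4 * ρ) + 1 / 2)))
  unfold tkBound
  set y : ℝ := (n : ℝ) + 1 / 2 with hy
  have hn : |(n : ℝ)| ≤ |y| + 1 / 2 := by
    have : (n : ℝ) = y - 1 / 2 := by rw [hy]; ring
    rw [this]
    refine (abs_sub _ _).trans ?_
    norm_num
  have h1 : |y| ^ k ≤ k.factorial * Real.exp |y| := by
    have := Real.pow_div_factorial_le_exp |y| (abs_nonneg _) k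
    rw [div_le_iff₀ (by positivity)] at this
    linarith
  have h2 : -ρ * y ^ 2 + (M + 2) * |y| ≤ (M + 2) ^ 2 / (4 * ρ) := by
    rw [le_div_iff₀ (by positivity), ← sq_abs y]
    nlinarith [sq_nonneg (2 * ρ * |y| - (M + 2))]
  calc |y| ^ k * Real.exp (-ρ * y ^ 2 + |y| * M)
      ≤ k.factorial * Real.exp |y| * Real.exp (-ρ * y ^ 2 + |y| * M) := by gcongr
    _ = k.factorial * Real.exp (|y| + (-ρ * y ^ 2 + |y| * M)) := by rw [Real.exp_add |y|]; ring
    _ ≤ k.factorial * Real.exp (((M + 2) ^ 2 / (4 * ρ) + 1 / 2) + -|(n : ℝ)|) := by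
        refine mul_le_mul_of_nonneg_left (Real.exp_le_exp.mpr ?_) (by positivity)
        linarith
    _ = _ := by rw [Real.exp_add (_ + _)]; ring

lemma summable_tkTerm (k : ℕ) {r : ℝ} (hr : 0 < r) (z : ℂ) : Summable (tkTerm k r z) :=
  Summable.of_norm_bounded (summable_tkBound k hr |z.im|)
    (fun n => norm_tkTerm_le k le_rfl le_rfl n)

lemma hasDerivAt_Tk_z (k : ℕ) {r : ℝ} (hr : 0 < r) (z : ℂ) :
    HasDerivAt (Tk k r) (Tk (k + 1) r z) z := by
  unfold Tk
  refine HasDerivAt.const_mul _ ?_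
  have hopen : IsOpen {w : ℂ | |w.im| < |z.im| + 1} :=
    isOpen_lt (by fun_prop) continuous_const
  have hconv : Convex ℝ {w : ℂ | |w.im| < |z.im| + 1} := by
    have : {w : ℂ | |w.im| < |z.im| + 1} =
        Complex.imLm ⁻¹' (Metric.ball 0 (|z.im| + 1)) := by
      ext w; simp [Complex.imLm]
    rw [this]
    exact (convex_ball _ _).linear_preimage Complex.imLm
  refine hasDerivAt_tsum_of_isPreconnected (summable_tkBound (k + 1) hr (|z.im| + 1))
    hopen hconv.isPreconnected (fun n y hy => ?_)
    (fun n y hy => norm_tkTerm_le (k + 1) le_rfl (le_of_lt hy) n)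
    (y₀ := z) (by simp) (summable_tkTerm k hr z) (by simp)
  unfold tkTerm
  have h := (((hasDerivAt_id y).const_mul (((n : ℂ) + 1 / 2) * Complex.I)).cexp.const_mul
    ((((n : ℂ) + 1 / 2) * Complex.I) ^ k)).const_mul
    ((-1 : ℂ) ^ n * Complex.exp (-(r : ℂ) * ((n : ℂ) + 1 / 2) ^ 2))
  refine h.congr_deriv ?_
  simp only [id]
  ring

lemma hasDerivAt_Tk_r (k : ℕ) {r : ℝ} (hr : 0 < r) (z : ℂ) :
    HasDerivAt (fun s : ℝ => Tk k s z) (Tk (k + 2) r z) r := by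
  unfold Tk
  refine HasDerivAt.const_mul _ ?_
  refine hasDerivAt_tsum_of_isPreconnected (summable_tkBound (k + 2) (half_pos hr) |z.im|)
    (isOpen_Ioi (a := r / 2)) isPreconnected_Ioi (fun n y hy => ?_)
    (fun n y hy => norm_tkTerm_le (k + 2) (le_of_lt hy) le_rfl n)
    (y₀ := r) (by simp [hr]) (summable_tkTerm k hr z) (by simp [hr])
  unfold tkTerm
  have h0 : HasDerivAt (fun s : ℝ => -(s : ℂ) * ((n : ℂ) + 1 / 2) ^ 2)
      (-1 * ((n : ℂ) + 1 / 2) ^ 2) y :=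
    (Complex.ofRealCLM.hasDerivAt.neg).mul_const _
  have h := ((h0.cexp).const_mul ((-1 : ℂ) ^ n)).mul_const
    ((((n : ℂ) + 1 / 2) * Complex.I) ^ k * Complex.exp (((n : ℂ) + 1 / 2) * Complex.I * z))
  refine h.congr_deriv ?_
  have hI : (((n : ℂ) + 1 / 2) * Complex.I) ^ (k + 2) =
      -((n : ℂ) + 1 / 2) ^ 2 * (((n : ℂ) + 1 / 2) * Complex.I) ^ k := by
    rw [pow_add, mul_pow _ Complex.I 2, Complex.I_sq]; ring
  rw [hI]
  ring

lemma Tk_real_im (k : ℕ) (r x : ℝ) : (Tk k r (x : ℂ)).im = 0 := by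
  rw [← Complex.conj_eq_iff_im]
  unfold Tk
  rw [map_mul, Complex.conj_tsum, ← (Equiv.subLeft (-1 : ℤ)).tsum_eq]
  have : ∀ n : ℤ, (starRingEnd ℂ) (tkTerm k r x (Equiv.subLeft (-1 : ℤ) n)) = - tkTerm k r x n := by
    intro n
    simp only [tkTerm, Equiv.subLeft_apply, map_mul, map_pow, map_zpow₀, ← Complex.exp_conj, map_neg,
      map_one, map_add, map_div₀, Complex.conj_I, Complex.conj_ofReal, map_intCast, map_ofNat]
    have e1 : ((-1 - n : ℤ) : ℂ) + 1 / 2 = -((n : ℂ) + 1 / 2) := by push_cast; ring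
    have e2 : (-1 : ℂ) ^ (-1 - n) = - (-1) ^ n := by
      rw [zpow_sub₀ (by norm_num), zpow_neg_one, div_eq_mul_inv, ← inv_zpow]
      norm_num
    rw [e1, e2]
    ring_nf
  simp_rw [this, tsum_neg]
  simp

noncomputable def poch (Q : ℝ) (N : ℕ) : ℝ := ∏ k ∈ Finset.range N, (1 - Q ^ (k + 1))

noncomputable def rc (Q : ℝ) (k : ℤ) : ℝ := if 0 ≤ k then (poch Q k.toNat)⁻¹ else 0

lemma one_sub_pow_pos {Q : ℝ} (h0 : 0 < Q) (h1 : Q < 1) (k : ℕ) : 0 < 1 - Q ^ (k + 1) := by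
  have := pow_lt_one₀ h0.le h1 (Nat.succ_ne_zero k)
  simpa using this

lemma poch_pos {Q : ℝ} (h0 : 0 < Q) (h1 : Q < 1) (N : ℕ) : 0 < poch Q N :=
  Finset.prod_pos fun k _ => one_sub_pow_pos h0 h1 k

lemma poch_le_one {Q : ℝ} (h0 : 0 < Q) (h1 : Q < 1) (N : ℕ) : poch Q N ≤ 1 :=
  Finset.prod_le_one (fun k _ => (one_sub_pow_pos h0 h1 k).le)
    (fun k _ => by have := pow_pos h0 (k + 1); linarith)

lemma poch_succ (Q : ℝ) (N : ℕ) : poch Q (N + 1) = poch Q N * (1 - Q ^ (N + 1)) :=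
  Finset.prod_range_succ _ _

lemma rc_sub_one {Q : ℝ} (h0 : 0 < Q) (h1 : Q < 1) (k : ℤ) :
    rc Q (k - 1) = rc Q k * (1 - Q ^ k) := by
  unfold rc
  rcases lt_trichotomy k 0 with hk | hk | hk
  · rw [if_neg (by lia), if_neg (by lia)]; simp
  · subst hk; simp
  · obtain ⟨m, rfl⟩ : ∃ m : ℕ, k = m + 1 := ⟨(k - 1).toNat, by lia⟩
    rw [if_pos (by lia), if_pos (by lia)]
    have e1 : ((m : ℤ) + 1 - 1).toNat = m := by lia
    have e2 : ((m : ℤ) + 1).toNat = m + 1 := by lia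
    rw [e1, e2, poch_succ]
    have h2 := one_sub_pow_pos h0 h1 m
    have h3 := poch_pos h0 h1 m
    have e3 : Q ^ ((m : ℤ) + 1) = Q ^ (m + 1) := by exact_mod_cast zpow_natCast Q (m + 1)
    rw [e3]
    field_simp

noncomputable def aco (q : ℝ) (N : ℕ) (n : ℤ) : ℝ :=
  (-1) ^ n * q ^ (n * (n + 1)) * poch (q ^ 2) (2 * N) * rc (q ^ 2) (N + n) * rc (q ^ 2) (N - n)

lemma aco_succ {q : ℝ} (h0 : 0 < q) (h1 : q < 1) (N : ℕ) (n : ℤ) :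
    aco q (N + 1) n = aco q N n * (1 + (q ^ 2) ^ (2 * N + 1)) - (q ^ 2) ^ (N + 1) * aco q N (n - 1)
      - (q ^ 2) ^ N * aco q N (n + 1) := by
  have hQ0 : 0 < q ^ 2 := by positivity
  have hQ1 : q ^ 2 < 1 := pow_lt_one₀ h0.le h1 (by norm_num)
  unfold aco
  have r1 := rc_sub_one hQ0 hQ1 (N + 1 + n)
  have r2 := rc_sub_one hQ0 hQ1 (N + n)
  have s1 := rc_sub_one hQ0 hQ1 (N + 1 - n)
  have s2 := rc_sub_one hQ0 hQ1 (N - n)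
  rw [show (N : ℤ) + 1 + n - 1 = N + n by ring] at r1
  rw [show (N : ℤ) + 1 - n - 1 = N - n by ring] at s1
  rw [show 2 * (N + 1) = 2 * N + 1 + 1 by ring, poch_succ, poch_succ,
    show (N : ℤ) + (n - 1) = N + n - 1 by ring, show (N : ℤ) - (n - 1) = N + 1 - n by ring,
    show (N : ℤ) + (n + 1) = N + 1 + n by ring, show (N : ℤ) - (n + 1) = N - n - 1 by ring,
    r2, s2, r1, s1]
  push_cast
  generalize rc (q ^ 2) ((N : ℤ) + 1 + n) = R
  generalize rc (q ^ 2) ((N : ℤ) + 1 - n) = S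
  have hq : q ≠ 0 := h0.ne'
  have hm : (-1 : ℝ) ≠ 0 := by norm_num
  have e1 : q ^ ((n - 1) * (n - 1 + 1)) = q ^ (n * (n + 1)) / (q ^ n) ^ 2 := by
    rw [show (n - 1) * (n - 1 + 1) = n * (n + 1) - (n + n) by ring, zpow_sub₀ hq, zpow_add₀ hq, sq]
  have e2 : q ^ ((n + 1) * (n + 1 + 1)) = q ^ (n * (n + 1)) * (q ^ n) ^ 2 * q ^ 2 := by
    rw [show (n + 1) * (n + 1 + 1) = n * (n + 1) + (n + n) + 2 by ring, zpow_add₀ hq, zpow_add₀ hq,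
      zpow_add₀ hq, sq (q ^ n)]
    norm_cast
  have z1 : (q ^ 2) ^ (N + 1 + n : ℤ) = q ^ 2 * (q ^ N) ^ 2 * (q ^ n) ^ 2 := by
    rw [zpow_add₀ hQ0.ne', zpow_add₀ hQ0.ne', zpow_one, zpow_natCast]
    have : (q ^ 2) ^ n = (q ^ n) ^ 2 := by
      rw [← zpow_natCast, ← zpow_natCast, ← zpow_mul, ← zpow_mul, mul_comm]
    rw [this]; ring
  have z2 : (q ^ 2) ^ (N + n : ℤ) = (q ^ N) ^ 2 * (q ^ n) ^ 2 := by
    rw [zpow_add₀ hQ0.ne', zpow_natCast]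
    have : (q ^ 2) ^ n = (q ^ n) ^ 2 := by
      rw [← zpow_natCast, ← zpow_natCast, ← zpow_mul, ← zpow_mul, mul_comm]
    rw [this]; ring
  have z3 : (q ^ 2) ^ (N + 1 - n : ℤ) = q ^ 2 * (q ^ N) ^ 2 / (q ^ n) ^ 2 := by
    rw [zpow_sub₀ hQ0.ne', zpow_add₀ hQ0.ne', zpow_one, zpow_natCast]
    have : (q ^ 2) ^ n = (q ^ n) ^ 2 := by
      rw [← zpow_natCast, ← zpow_natCast, ← zpow_mul, ← zpow_mul, mul_comm]
    rw [this]; ring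
  have z4 : (q ^ 2) ^ (N - n : ℤ) = (q ^ N) ^ 2 / (q ^ n) ^ 2 := by
    rw [zpow_sub₀ hQ0.ne', zpow_natCast]
    have : (q ^ 2) ^ n = (q ^ n) ^ 2 := by
      rw [← zpow_natCast, ← zpow_natCast, ← zpow_mul, ← zpow_mul, mul_comm]
    rw [this]; ring
  have y1 : (q ^ 2) ^ (2 * N + 1) = q ^ 2 * (q ^ N) ^ 4 := by ring
  have y2 : (q ^ 2) ^ (2 * N + 1 + 1) = q ^ 4 * (q ^ N) ^ 4 := by ring
  have y3 : (q ^ 2) ^ (N + 1) = q ^ 2 * (q ^ N) ^ 2 := by ring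
  have y4 : (q ^ 2) ^ N = (q ^ N) ^ 2 := by ring
  have m1 : (-1 : ℝ) ^ (n - 1) = - (-1) ^ n := by rw [zpow_sub_one₀ hm]; norm_num
  have m2 : (-1 : ℝ) ^ (n + 1) = - (-1) ^ n := by rw [zpow_add_one₀ hm]; norm_num
  rw [e1, e2, z1, z2, z3, z4, y1, y2, y3, y4, m1, m2]
  have hX : q ^ n ≠ 0 := zpow_ne_zero _ hq
  generalize q ^ n = X at *
  generalize q ^ N = A at *
  generalize q ^ (n * (n + 1)) = U at *
  field_simp
  ring

lemma hasSum_conv {ι : Type*} {f g : ι → ℂ} {a b : ℂ} (h : HasSum f a) (h1 : ∀ i, g i = f i)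
    (h2 : b = a) : HasSum g b := by
  rw [h2, show g = f from funext h1]; exact h

lemma finite_jtp {q : ℝ} (h0 : 0 < q) (h1 : q < 1) {w : ℂ} (hw : w ≠ 0) (N : ℕ) :
    HasSum (fun n : ℤ => (aco q N n : ℂ) * w ^ n)
      (∏ k ∈ Finset.range N, ((1 - w * ((q : ℂ) ^ 2) ^ (k + 1)) * (1 - w⁻¹ * ((q : ℂ) ^ 2) ^ k))) := by
  induction N with
  | zero =>
    have h := hasSum_single (f := fun n : ℤ => (aco q 0 n : ℂ) * w ^ n) 0 (by
      intro n hn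
      have : aco q 0 n = 0 := by
        unfold aco rc
        rcases lt_or_gt_of_ne hn with h | h
        · rw [if_neg (by simpa using h)]; simp
        · rw [if_neg (show ¬ (0 ≤ ((0 : ℕ) : ℤ) - n) by simpa using h)]; simp
      simp [this])
    convert h using 1
    simp [aco, rc, poch]
  | succ N ih =>
    rw [Finset.prod_range_succ]
    have s1 := (Equiv.subRight (1 : ℤ)).hasSum_iff.mpr ih
    have s2 := (Equiv.addRight (1 : ℤ)).hasSum_iff.mpr ih
    have h := ((ih.mul_right (1 + ((q : ℂ) ^ 2) ^ (2 * N + 1))).sub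
      (s1.mul_left (((q : ℂ) ^ 2) ^ (N + 1) * w))).sub (s2.mul_left (((q : ℂ) ^ 2) ^ N * w⁻¹))
    refine hasSum_conv h (fun n => ?_) ?_
    · rw [aco_succ h0 h1]
      simp only [Function.comp, Equiv.subRight_apply, Equiv.coe_addRight]
      rw [zpow_sub_one₀ hw, zpow_add_one₀ hw]
      push_cast
      field_simp
    · generalize (∏ k ∈ Finset.range N, ((1 - w * ((q : ℂ) ^ 2) ^ (k + 1)) *
        (1 - w⁻¹ * ((q : ℂ) ^ 2) ^ k))) = L
      field_simp
      ring

open Filter Topology in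
lemma exists_poch_lim {Q : ℝ} (h0 : 0 < Q) (h1 : Q < 1) :
    ∃ E : ℝ, 0 < E ∧ Tendsto (poch Q) atTop (𝓝 E) ∧ ∀ N, E ≤ poch Q N := by
  have hs : Summable (fun k : ℕ => ‖-(Q ^ (k + 1))‖) := by
    simp only [norm_neg, norm_pow, Real.norm_eq_abs, abs_of_pos h0]
    exact (summable_nat_add_iff 1).mpr (summable_geometric_of_lt_one h0.le h1)
  have hm := multipliable_one_add_of_summable hs
  have ht : Tendsto (poch Q) atTop (𝓝 (∏' k : ℕ, (1 + -(Q ^ (k + 1))))) := by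
    have := hm.hasProd.tendsto_prod_nat
    simpa only [← sub_eq_add_neg] using! this
  have hne : ∏' k : ℕ, (1 + -(Q ^ (k + 1))) ≠ 0 := by
    refine tprod_one_add_ne_zero_of_summable (fun k => ?_) hs
    have := one_sub_pow_pos h0 h1 k
    rw [← sub_eq_add_neg]
    exact this.ne'
  have hanti : Antitone (poch Q) := antitone_nat_of_succ_le fun n => by
    rw [poch_succ]
    have h2 := poch_pos h0 h1 n
    have h3 := pow_pos h0 (n + 1)
    nlinarith
  have hge : 0 ≤ ∏' k : ℕ, (1 + -(Q ^ (k + 1))) :=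
    ge_of_tendsto' ht (fun n => (poch_pos h0 h1 n).le)
  exact ⟨_, lt_of_le_of_ne hge hne.symm, ht, fun N => hanti.le_of_tendsto ht N⟩

/-- The infinite product `∏ (1 - w Q^(k+1))`. -/
noncomputable def Fp (Q : ℝ) (w : ℂ) : ℂ := ∏' k : ℕ, (1 + -(w * (Q : ℂ) ^ (k + 1)))

lemma summable_Fp {Q : ℝ} (h0 : 0 < Q) (h1 : Q < 1) (w : ℂ) :
    Summable (fun k : ℕ => ‖-(w * (Q : ℂ) ^ (k + 1))‖) := by
  simp only [norm_neg, norm_mul, norm_pow, Complex.norm_real, Real.norm_eq_abs, abs_of_pos h0]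
  exact ((summable_nat_add_iff 1).mpr (summable_geometric_of_lt_one h0.le h1)).mul_left _

open Filter Topology in
lemma tendsto_Fp {Q : ℝ} (h0 : 0 < Q) (h1 : Q < 1) (w : ℂ) :
    Tendsto (fun N : ℕ => ∏ k ∈ Finset.range N, (1 - w * (Q : ℂ) ^ (k + 1))) atTop (𝓝 (Fp Q w)) := by
  have := (multipliable_one_add_of_summable (summable_Fp h0 h1 w)).hasProd.tendsto_prod_nat
  simpa only [← sub_eq_add_neg, Fp] using! this

lemma Fp_ne_zero {Q : ℝ} (h0 : 0 < Q) (h1 : Q < 1) {w : ℂ} (hw : ‖w‖ ≤ 1) : Fp Q w ≠ 0 := by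
  refine tprod_one_add_ne_zero_of_summable (fun k h => ?_) (summable_Fp h0 h1 w)
  have h2 : w * (Q : ℂ) ^ (k + 1) = 1 := by linear_combination -h
  have h3 := congrArg norm h2
  rw [norm_mul, norm_pow, Complex.norm_real, Real.norm_eq_abs, abs_of_pos h0, norm_one] at h3
  have h4 := one_sub_pow_pos h0 h1 k
  have h5 := pow_pos h0 (k + 1)
  nlinarith

open Filter Topology in
lemma continuousAt_Fp_one {Q : ℝ} (h0 : 0 < Q) (h1 : Q < 1) : ContinuousAt (Fp Q) 1 := by
  unfold ContinuousAt Fp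
  refine tendsto_tprod_one_add_of_dominated_convergence (bound := fun k : ℕ => 2 * Q ^ (k + 1)) ?_ ?_ ?_
  · exact ((summable_nat_add_iff 1).mpr (summable_geometric_of_lt_one h0.le h1)).mul_left _
  · intro k
    exact ((continuous_id.mul continuous_const).neg).tendsto 1
  · have : ∀ᶠ w : ℂ in 𝓝 1, ‖w‖ < 2 := (isOpen_lt continuous_norm continuous_const).mem_nhds (by simp)
    filter_upwards [this] with w hw k
    rw [norm_neg, norm_mul, norm_pow, Complex.norm_real, Real.norm_eq_abs, abs_of_pos h0]
    gcongr

open Filter Topology in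
lemma poch_lim_eq {Q : ℝ} (h0 : 0 < Q) (h1 : Q < 1) :
    Tendsto (fun N => ((poch Q N : ℝ) : ℂ)) atTop (𝓝 (Fp Q 1)) := by
  refine (tendsto_Fp h0 h1 1).congr (fun N => ?_)
  simp [poch]

open Filter Topology in
lemma jtp {q : ℝ} (h0 : 0 < q) (h1 : q < 1) {w : ℂ} (hw : w ≠ 0)
    (hs : Summable (fun n : ℤ => (-1 : ℂ) ^ n * (q : ℂ) ^ (n * (n + 1)) * w ^ n)) :
    ∑' n : ℤ, (-1 : ℂ) ^ n * (q : ℂ) ^ (n * (n + 1)) * w ^ n =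
      Fp (q ^ 2) 1 * (Fp (q ^ 2) w * ((1 - w⁻¹) * Fp (q ^ 2) w⁻¹)) := by
  have hQ0 : 0 < q ^ 2 := by positivity
  have hQ1 : q ^ 2 < 1 := pow_lt_one₀ h0.le h1 (by norm_num)
  obtain ⟨E, hE0, hE, hEle⟩ := exists_poch_lim hQ0 hQ1
  have hEF : Fp (q ^ 2) 1 = (E : ℂ) :=
    tendsto_nhds_unique (poch_lim_eq hQ0 hQ1) ((Complex.continuous_ofReal.tendsto E).comp hE)
  have hrc0 : ∀ k, 0 ≤ rc (q ^ 2) k := fun k => by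
    unfold rc; split_ifs
    · exact (inv_pos.mpr (poch_pos hQ0 hQ1 _)).le
    · exact le_rfl
  have hrc1 : ∀ k, rc (q ^ 2) k ≤ E⁻¹ := fun k => by
    unfold rc; split_ifs
    · exact inv_anti₀ hE0 (hEle _)
    · exact (inv_pos.mpr hE0).le
  have hrcl : Tendsto (rc (q ^ 2)) atTop (𝓝 E⁻¹) := by
    have ht : Tendsto Int.toNat atTop atTop := by
      refine tendsto_atTop.mpr fun b => ?_
      filter_upwards [eventually_ge_atTop (b : ℤ)] with a ha
      lia
    refine ((hE.comp ht).inv₀ hE0.ne').congr' ?_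
    filter_upwards [eventually_ge_atTop (0 : ℤ)] with a ha
    simp [rc, ha]
  have hlim : ∀ n : ℤ, Tendsto (fun N : ℕ => (aco q N n : ℂ) * w ^ n) atTop
      (𝓝 ((E : ℂ)⁻¹ * ((-1 : ℂ) ^ n * (q : ℂ) ^ (n * (n + 1)) * w ^ n))) := by
    intro n
    have t1 : Tendsto (fun N : ℕ => (N : ℤ) + n) atTop atTop :=
      tendsto_atTop_add_const_right _ _ tendsto_natCast_atTop_atTop
    have t2 : Tendsto (fun N : ℕ => (N : ℤ) - n) atTop atTop :=
      tendsto_atTop_add_const_right _ _ tendsto_natCast_atTop_atTop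
    have t3 : Tendsto (fun N : ℕ => 2 * N) atTop atTop :=
      tendsto_id.const_mul_atTop' (by norm_num)
    have h := ((((hE.comp t3).const_mul ((-1) ^ n * q ^ (n * (n + 1)))).mul (hrcl.comp t1)).mul
      (hrcl.comp t2))
    have h2 := ((Complex.continuous_ofReal.tendsto _).comp h).mul_const (w ^ n)
    refine (h2.congr fun N => rfl).trans (le_of_eq ?_)
    congr 1
    have : (E : ℂ) ≠ 0 := by exact_mod_cast hE0.ne'
    push_cast
    field_simp
  have hT := tendsto_tsum_of_dominated_convergence (𝓕 := atTop)
    (f := fun (N : ℕ) (n : ℤ) => (aco q N n : ℂ) * w ^ n)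
    (bound := fun n : ℤ => (E⁻¹ * E⁻¹) * ‖(-1 : ℂ) ^ n * (q : ℂ) ^ (n * (n + 1)) * w ^ n‖)
    (hs.norm.mul_left _) hlim (Eventually.of_forall fun N n => by
      rw [norm_mul, Complex.norm_real]
      unfold aco
      rw [norm_mul, norm_mul, norm_mul, norm_mul, norm_mul, norm_mul, norm_zpow, norm_zpow, norm_zpow,
        norm_zpow, norm_zpow, norm_neg, norm_neg, norm_one, norm_one, Complex.norm_real,
        Real.norm_of_nonneg (hrc0 _), Real.norm_of_nonneg (hrc0 _),
        Real.norm_of_nonneg (poch_pos hQ0 hQ1 _).le]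
      simp only [one_zpow, one_mul]
      have hp := poch_le_one hQ0 hQ1 (2 * N)
      have hp0 := poch_pos hQ0 hQ1 (2 * N)
      calc ‖q‖ ^ (n * (n + 1)) * poch (q ^ 2) (2 * N) * rc (q ^ 2) (N + n) * rc (q ^ 2) (N - n) * ‖w‖ ^ n
          ≤ ‖q‖ ^ (n * (n + 1)) * 1 * E⁻¹ * E⁻¹ * ‖w‖ ^ n := by
            have := hrc0 ((N : ℤ) + n)
            have := hrc0 ((N : ℤ) - n)
            gcongr
            · exact hrc1 _
            · exact hrc1 _
        _ = _ := by ring)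
  have hP : Tendsto (fun N : ℕ => ∑' n : ℤ, (aco q N n : ℂ) * w ^ n) atTop
      (𝓝 (Fp (q ^ 2) w * ((1 - w⁻¹) * Fp (q ^ 2) w⁻¹))) := by
    simp_rw [(finite_jtp h0 h1 hw _).tsum_eq]
    simp_rw [Finset.prod_mul_distrib]
    refine Tendsto.mul ?_ ?_
    · simpa using! tendsto_Fp hQ0 hQ1 w
    · rw [← tendsto_add_atTop_iff_nat 1]
      simp_rw [Finset.prod_range_succ']
      have := (tendsto_Fp hQ0 hQ1 w⁻¹).mul_const (1 - w⁻¹)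
      rw [mul_comm (1 - w⁻¹) (Fp (q ^ 2) w⁻¹)]
      simpa using! this
  have := tendsto_nhds_unique hT hP
  rw [tsum_mul_left] at this
  rw [← this, hEF]
  have : (E : ℂ) ≠ 0 := by exact_mod_cast hE0.ne'
  field_simp

lemma tkTerm_zero_eq {r : ℝ} (z : ℂ) (n : ℤ) :
    tkTerm 0 r z n = (Complex.exp (-(r : ℂ) / 4) * Complex.exp (Complex.I * z / 2)) *
      ((-1 : ℂ) ^ n * ((Real.exp (-r) : ℝ) : ℂ) ^ (n * (n + 1)) * Complex.exp (Complex.I * z) ^ n) := by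
  unfold tkTerm
  rw [Complex.ofReal_exp, ← Complex.exp_int_mul, ← Complex.exp_int_mul, pow_zero, one_mul]
  have e : Complex.exp (-(r : ℂ) * ((n : ℂ) + 1 / 2) ^ 2) * Complex.exp (((n : ℂ) + 1 / 2) * Complex.I * z)
    = Complex.exp (-(r : ℂ) / 4) * Complex.exp (Complex.I * z / 2) *
      (Complex.exp (((n * (n + 1) : ℤ) : ℂ) * ((-r : ℝ) : ℂ)) * Complex.exp ((n : ℂ) * (Complex.I * z))) := by
    simp only [← Complex.exp_add]
    congr 1
    push_cast
    ring
  linear_combination ((-1 : ℂ) ^ n) * e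

lemma exp_neg_lt_one' {r : ℝ} (hr : 0 < r) : Real.exp (-r) < 1 := by
  rw [Real.exp_lt_one_iff]; linarith

noncomputable def Gth (r : ℝ) (z : ℂ) : ℂ :=
  2 * Complex.exp (-(r : ℂ) / 4) * (Fp (Real.exp (-r) ^ 2) 1 *
    (Fp (Real.exp (-r) ^ 2) (Complex.exp (Complex.I * z)) *
      Fp (Real.exp (-r) ^ 2) (Complex.exp (Complex.I * z))⁻¹))

lemma Theta_prod {r : ℝ} (hr : 0 < r) (z : ℂ) :
    Theta r z = Complex.sin (z / 2) * Gth r z := by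
  have hpre : Complex.exp (-(r : ℂ) / 4) * Complex.exp (Complex.I * z / 2) ≠ 0 :=
    mul_ne_zero (Complex.exp_ne_zero _) (Complex.exp_ne_zero _)
  have hs := summable_tkTerm 0 hr z
  rw [show tkTerm 0 r z = _ from funext fun n => tkTerm_zero_eq z n] at hs
  rw [summable_mul_left_iff hpre] at hs
  rw [Theta_eq_Tk, Tk]
  simp_rw [tkTerm_zero_eq]
  rw [tsum_mul_left, jtp (Real.exp_pos _) (exp_neg_lt_one' hr) (Complex.exp_ne_zero _) hs, Gth,
    Complex.sin]
  have e : Complex.exp (Complex.I * z / 2) * (1 - (Complex.exp (Complex.I * z))⁻¹) =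
      Complex.exp (z / 2 * Complex.I) - Complex.exp (-(z / 2) * Complex.I) := by
    rw [← Complex.exp_neg, mul_sub, ← Complex.exp_add, mul_one]
    congr 2 <;> ring
  have eI : (1 / Complex.I) = - Complex.I := by simp
  rw [eI]
  linear_combination (-Complex.I * Complex.exp (-(r : ℂ) / 4) * Fp (Real.exp (-r) ^ 2) 1 *
    (Fp (Real.exp (-r) ^ 2) (Complex.exp (Complex.I * z)) *
      Fp (Real.exp (-r) ^ 2) (Complex.exp (Complex.I * z))⁻¹)) * e

lemma sq_exp_bounds {r : ℝ} (hr : 0 < r) : 0 < Real.exp (-r) ^ 2 ∧ Real.exp (-r) ^ 2 < 1 := by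
  have := exp_neg_lt_one' hr
  have h := Real.exp_pos (-r)
  constructor
  · positivity
  · nlinarith

lemma Theta_ne_zero {r : ℝ} (hr : 0 < r) {x : ℝ} (hx : x ∈ Set.Ioo 0 (2 * Real.pi)) :
    Theta r x ≠ 0 := by
  obtain ⟨h0, h1⟩ := sq_exp_bounds hr
  have hw : ‖Complex.exp (Complex.I * x)‖ = 1 := by
    rw [mul_comm]; exact Complex.norm_exp_ofReal_mul_I x
  rw [Theta_prod hr, Gth]
  refine mul_ne_zero ?_ (mul_ne_zero (mul_ne_zero two_ne_zero (Complex.exp_ne_zero _))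
    (mul_ne_zero (Fp_ne_zero h0 h1 (by simp)) (mul_ne_zero (Fp_ne_zero h0 h1 hw.le)
      (Fp_ne_zero h0 h1 (by rw [norm_inv, hw]; simp)))))
  have : 0 < Real.sin (x / 2) := Real.sin_pos_of_pos_of_lt_pi (by linarith [hx.1]) (by linarith [hx.2])
  have e : Complex.sin ((x : ℂ) / 2) = ((Real.sin (x / 2) : ℝ) : ℂ) := by push_cast; rfl
  rw [e]
  exact_mod_cast this.ne'

open Filter Topology in
lemma hasDerivAt_mul_of_continuousAt {f g : ℂ → ℂ} {f' : ℂ} (hf : HasDerivAt f f' 0) (h0 : f 0 = 0)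
    (hg : ContinuousAt g 0) : HasDerivAt (fun z => f z * g z) (f' * g 0) 0 := by
  rw [hasDerivAt_iff_tendsto_slope] at hf ⊢
  have := hf.mul (hg.tendsto.mono_left nhdsWithin_le_nhds)
  refine this.congr fun z => ?_
  simp [slope_def_field, h0]
  ring

lemma hasDerivAt_Theta_zero {r : ℝ} (hr : 0 < r) :
    HasDerivAt (Theta r) (Complex.exp (-(r : ℂ) / 4) * Fp (Real.exp (-r) ^ 2) 1 ^ 3) 0 := by
  obtain ⟨h0, h1⟩ := sq_exp_bounds hr
  have hg : ContinuousAt (Gth r) 0 := by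
    unfold Gth
    have hc := continuousAt_Fp_one h0 h1
    have e1 : ContinuousAt (fun z => Fp (Real.exp (-r) ^ 2) (Complex.exp (Complex.I * z))) 0 := by
      refine ContinuousAt.comp (f := fun z => Complex.exp (Complex.I * z)) (g := Fp (Real.exp (-r) ^ 2)) ?_ (by fun_prop)
      simpa using hc
    have e2 : ContinuousAt (fun z => Fp (Real.exp (-r) ^ 2) (Complex.exp (Complex.I * z))⁻¹) 0 := by
      refine ContinuousAt.comp (f := fun z => (Complex.exp (Complex.I * z))⁻¹) (g := Fp (Real.exp (-r) ^ 2)) ?_ ?_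
      · simpa using hc
      · exact ContinuousAt.inv₀ (by fun_prop) (Complex.exp_ne_zero _)
    exact continuousAt_const.mul (continuousAt_const.mul (e1.mul e2))
  have hf : HasDerivAt (fun z : ℂ => Complex.sin (z / 2)) (1 / 2) 0 := by
    have := (Complex.hasDerivAt_sin ((0 : ℂ) / 2)).comp (0 : ℂ) ((hasDerivAt_id (0 : ℂ)).div_const 2)
    simpa using! this
  have := hasDerivAt_mul_of_continuousAt hf (by simp) hg
  have e : Theta r = fun z => Complex.sin (z / 2) * Gth r z := funext fun z => Theta_prod hr z
  rw [e]
  refine this.congr_deriv ?_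
  simp [Gth]
  ring

lemma pi_im_pos {r : ℝ} (hr : 0 < r) : 0 < (Complex.I * r / Real.pi : ℂ).im := by
  have e : (Complex.I * r / Real.pi : ℂ) = ((r / Real.pi : ℝ) : ℂ) * Complex.I := by
    push_cast; ring
  rw [e]
  simp
  positivity

lemma deriv_Theta_zero_eta {r : ℝ} (hr : 0 < r) :
    deriv (Theta r) 0 = ModularForm.eta (Complex.I * r / Real.pi) ^ 3 := by
  rw [(hasDerivAt_Theta_zero hr).deriv, ModularForm.eta, mul_pow]
  have hpi : (Real.pi : ℂ) ≠ 0 := by exact_mod_cast Real.pi_ne_zero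
  congr 1
  · rw [Function.Periodic.qParam, ← Complex.exp_nat_mul]
    congr 1
    push_cast
    field_simp
    ring_nf
    simp
  · congr 1
    unfold Fp
    refine tprod_congr fun n => ?_
    rw [ModularForm.eta_q_eq_pow, sub_eq_add_neg, one_mul]
    congr 3
    push_cast
    rw [← Complex.exp_nat_mul]
    congr 1
    push_cast
    field_simp
    simp

noncomputable def tauPt (r : ℝ) (hr : 0 < r) : UpperHalfPlane :=
  ⟨Complex.I * r / Real.pi, pi_im_pos hr⟩

lemma deriv_Theta_zero_ne {r : ℝ} (hr : 0 < r) : deriv (Theta r) 0 ≠ 0 := by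
  rw [deriv_Theta_zero_eta hr]
  exact pow_ne_zero _ (ModularForm.eta_ne_zero (pi_im_pos hr))

lemma hasDerivAt_A {r : ℝ} (hr : 0 < r) :
    HasDerivAt (fun s : ℝ => deriv (Theta s) 0)
      (-(1 / 4) * EisensteinSeries.E2 (tauPt r hr) * deriv (Theta r) 0) r := by
  have hpi : (Real.pi : ℂ) ≠ 0 := by exact_mod_cast Real.pi_ne_zero
  have hd := (ModularForm.differentiableAt_eta_of_mem_upperHalfPlaneSet (pi_im_pos hr)).hasDerivAt
  have hl := ModularForm.logDeriv_eta_eq_E2 (tauPt r hr)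
  have hne := ModularForm.eta_ne_zero (pi_im_pos hr)
  have hcoe : ((tauPt r hr : UpperHalfPlane) : ℂ) = Complex.I * r / Real.pi := rfl
  rw [logDeriv_apply, hcoe, div_eq_iff hne] at hl
  have hin : HasDerivAt (fun s : ℝ => (Complex.I * s / Real.pi : ℂ)) (Complex.I / Real.pi) r := by
    have := ((hasDerivAt_id r).ofReal_comp.const_mul Complex.I).div_const (Real.pi : ℂ)
    simpa using! this
  have h3 := (hd.comp (r : ℝ) hin).pow 3
  refine (h3.congr_of_eventuallyEq (f₁ := fun s : ℝ => deriv (Theta s) 0) ?_).congr_deriv ?_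
  · filter_upwards [lt_mem_nhds hr] with s hs
    simpa using! deriv_Theta_zero_eta hs
  rw [hl, deriv_Theta_zero_eta hr]
  simp only [Function.comp]
  field_simp
  simp
  ring_nf

/-- Lattice point in the normalised lattice. -/
noncomputable def uPt (t : UpperHalfPlane) (q : ℤ × ℤ) : ℂ := (q.1 : ℂ) * (t : ℂ) + (q.2 : ℂ)

noncomputable def zF (t : UpperHalfPlane) (q : ℤ × ℤ) : ℂ :=
  if q = 0 then 0 else 1 / (1 - 2 * uPt t q) + 1 / (2 * uPt t q) + 1 / (4 * uPt t q ^ 2)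

lemma uPt_re {t : UpperHalfPlane} (ht : (t : ℂ).re = 0) (q : ℤ × ℤ) : (uPt t q).re = q.2 := by
  have ht' : t.re = 0 := ht
  simp [uPt, ht']

lemma uPt_im (t : UpperHalfPlane) (q : ℤ × ℤ) : (uPt t q).im = q.1 * (t : ℂ).im := by
  simp [uPt]

lemma uPt_ne_zero (t : UpperHalfPlane) {q : ℤ × ℤ} (hq : q ≠ 0) : uPt t q ≠ 0 := by
  intro h
  have him := congrArg Complex.im h
  have ht : (t : ℂ).im ≠ 0 := t.2.ne'
  rw [uPt_im] at him
  have h1 : q.1 = 0 := by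
    rcases mul_eq_zero.mp him with h' | h'
    · exact_mod_cast h'
    · exact absurd h' ht
  have h2 : q.2 = 0 := by
    rw [uPt, h1] at h
    simpa using h
  exact hq (Prod.ext h1 h2)

lemma uPt_neg (t : UpperHalfPlane) (q : ℤ × ℤ) : uPt t (-q) = - uPt t q := by
  simp [uPt]; ring

lemma norm_uPt_le {t : UpperHalfPlane} (ht : (t : ℂ).re = 0) (q : ℤ × ℤ) :
    ‖uPt t q‖ ≤ ‖1 - 2 * uPt t q‖ := by
  rw [Complex.norm_def, Complex.norm_def]
  apply Real.sqrt_le_sqrt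
  rw [Complex.normSq_apply, Complex.normSq_apply]
  simp only [Complex.sub_re, Complex.sub_im, Complex.mul_re, Complex.mul_im, Complex.one_re,
    Complex.one_im, Complex.re_ofNat, Complex.im_ofNat, zero_mul, sub_zero, add_zero, uPt_re ht]
  have h : (0 : ℤ) ≤ (3 * q.2 - 1) * (q.2 - 1) := by
    rcases le_or_gt q.2 0 with h | h
    · nlinarith
    · nlinarith
  have h' : (0 : ℝ) ≤ (3 * q.2 - 1) * (q.2 - 1) := by exact_mod_cast h
  nlinarith [sq_nonneg (uPt t q).im]

lemma one_sub_ne {t : UpperHalfPlane} (ht : (t : ℂ).re = 0) (q : ℤ × ℤ) :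
    1 - 2 * uPt t q ≠ 0 := by
  by_cases hq : q = 0
  · subst hq; simp [uPt]
  · have h1 := norm_uPt_le ht q
    have h2 := norm_pos_iff.mpr (uPt_ne_zero t hq)
    exact norm_pos_iff.mp (h2.trans_le h1)

lemma one_add_ne {t : UpperHalfPlane} (ht : (t : ℂ).re = 0) (q : ℤ × ℤ) :
    1 + 2 * uPt t q ≠ 0 := by
  have := one_sub_ne ht (-q)
  rw [uPt_neg] at this
  intro h
  apply this
  rw [← h]; ring

lemma zF_eq {t : UpperHalfPlane} (ht : (t : ℂ).re = 0) {q : ℤ × ℤ} (hq : q ≠ 0) :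
    zF t q = 1 / (4 * uPt t q ^ 2 * (1 - 2 * uPt t q)) := by
  have h1 := one_sub_ne ht q
  have h2 := uPt_ne_zero t hq
  rw [zF, if_neg hq]
  field_simp
  ring

lemma summable_zF {t : UpperHalfPlane} (ht : (t : ℂ).re = 0) : Summable (zF t) := by
  have hs := (EisensteinSeries.summable_one_div_norm_rpow (k := 3) (by norm_num))
  rw [← (finTwoArrowEquiv ℤ).symm.summable_iff] at hs
  refine Summable.of_norm_bounded (hs.mul_left (1 / 4 * EisensteinSeries.r t ^ (-3 : ℝ))) fun q => ?_
  by_cases hq : q = 0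
  · simp only [zF, hq, if_true, norm_zero]
    have := (EisensteinSeries.r_pos t).le
    simp only [Function.comp]
    positivity
  · have hb := EisensteinSeries.summand_bound t (k := 3) (by norm_num) ((finTwoArrowEquiv ℤ).symm q)
    have e : ((((finTwoArrowEquiv ℤ).symm q) 0 : ℤ) : ℂ) * (t : ℂ) + ((((finTwoArrowEquiv ℤ).symm q) 1 : ℤ) : ℂ)
      = uPt t q := by simp [uPt]
    rw [e] at hb
    have hpos := norm_pos_iff.mpr (uPt_ne_zero t hq)
    have hle := norm_uPt_le ht q
    rw [zF_eq ht hq, norm_div, norm_one, norm_mul, norm_mul, norm_pow]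
    calc 1 / (‖(4 : ℂ)‖ * ‖uPt t q‖ ^ 2 * ‖1 - 2 * uPt t q‖)
        ≤ 1 / (4 * ‖uPt t q‖ ^ 2 * ‖uPt t q‖) := by
          rw [show ‖(4 : ℂ)‖ = 4 by simp]
          gcongr
      _ = 1 / 4 * ‖uPt t q‖ ^ (-3 : ℝ) := by
          rw [Real.rpow_neg hpos.le, show ((3 : ℝ)) = ((3 : ℕ) : ℝ) by norm_num, Real.rpow_natCast]
          field_simp
      _ ≤ _ := by
          rw [mul_assoc]
          gcongr
          exact hb

noncomputable def zG (t : UpperHalfPlane) (n m : ℤ) : ℂ := 1 / (2 * uPt t (n, m) + 1)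

lemma norm_zG_le {t : UpperHalfPlane} (ht : (t : ℂ).re = 0) (n m : ℤ) :
    ‖zG t n m‖ ≤ 1 / |2 * (m : ℝ) + 1| := by
  rw [zG, norm_div, norm_one]
  have hne : 2 * (m : ℝ) + 1 ≠ 0 := by
    have : 2 * m + 1 ≠ 0 := by omega
    exact_mod_cast this
  have hp := abs_pos.mpr hne
  gcongr
  have := Complex.abs_re_le_norm (2 * uPt t (n, m) + 1)
  simpa [uPt_re ht] using this

noncomputable def zS (t : UpperHalfPlane) (q : ℤ × ℤ) : ℂ :=
  (zF t q + zF t (-q)) / 2 + if q = 0 then 1 else 0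

lemma pf_one {u : ℂ} (h0 : u ≠ 0) (h : 2 * u + 1 ≠ 0) :
    1 / (4 * (-u) ^ 2 * (2 * u + 1)) = (1 / 4) * (1 / u ^ 2) - (1 / 2) * (1 / u) + 1 / (2 * u + 1) := by
  have P := mul_inv_cancel₀ h0
  have Q := mul_inv_cancel₀ h
  rw [neg_sq]
  simp only [one_div, mul_inv, ← inv_pow]
  generalize u⁻¹ = a at *
  generalize (2 * u + 1)⁻¹ = b at *
  linear_combination (a ^ 2 / 4 - a / 2) * Q + (b - a * b / 2) * P

lemma pf_two {u : ℂ} (h0 : u ≠ 0) (h : 1 - 2 * u ≠ 0) :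
    1 / (4 * u ^ 2 * (1 - 2 * u)) = (1 / 4) * (1 / u ^ 2) + (1 / 2) * (1 / u) + 1 / (1 - 2 * u) := by
  have e : 2 * (-u) + 1 = 1 - 2 * u := by ring
  have := pf_one (neg_ne_zero.mpr h0) (e ▸ h)
  rw [e, neg_neg, neg_sq] at this
  rw [this]
  ring

lemma zS_eq {t : UpperHalfPlane} (ht : (t : ℂ).re = 0) (n m : ℤ) :
    zS t (n, m) = (zG t n m - zG t n (m - 1)) / 2 +
      (1 / 4) * EisensteinSeries.eisSummand 2 ![n, m] t := by
  have e1 : zG t n (m - 1) = - (1 / (1 - 2 * uPt t (n, m))) := by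
    rw [zG, ← div_neg]
    congr 1
    simp [uPt]; ring
  have e2 : EisensteinSeries.eisSummand 2 ![n, m] t = 1 / (uPt t (n, m)) ^ 2 := by
    simp [EisensteinSeries.eisSummand, uPt]
  have h1 := one_sub_ne ht (n, m)
  have h2 := one_add_ne ht (n, m)
  have h3 : 2 * uPt t (n, m) + 1 ≠ 0 := by rwa [add_comm]
  rw [e1, e2, zG, zS]
  by_cases hq : ((n, m) : ℤ × ℤ) = 0
  · have hn : n = 0 := congrArg Prod.fst hq
    have hm : m = 0 := congrArg Prod.snd hq
    subst hn hm
    simp [zF, uPt]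
  · have h0 := uPt_ne_zero t hq
    have hq' : -((n, m) : ℤ × ℤ) ≠ 0 := neg_ne_zero.mpr hq
    rw [zF_eq ht hq, zF_eq ht hq', uPt_neg, if_neg hq]
    generalize uPt t (n, m) = u at *
    have h4 : 1 - 2 * -u = 2 * u + 1 := by ring
    rw [h4]
    have f1 := pf_one h0 h3
    have f2 := pf_two h0 h1
    rw [f1, f2]
    ring

open Filter Topology in
lemma hasSum_fiber {t : UpperHalfPlane} (ht : (t : ℂ).re = 0) (hs : Summable (zS t)) (n : ℤ) :
    HasSum (fun m => zS t (n, m)) ((1 / 4) * EisensteinSeries.e2Summand n t) := by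
  have h1 : Summable (fun m => zS t (n, m)) := hs.prod_factor n
  have h2 := (EisensteinSeries.e2Summand_summable n t).mul_left (1 / 4)
  have h3 : Summable (fun m => (zG t n m - zG t n (m - 1)) / 2) := by
    refine (h1.sub h2).congr fun m => ?_
    rw [zS_eq ht]; ring
  have h4 : HasSum (fun m => (zG t n m - zG t n (m - 1)) / 2) 0 := by
    have ha := h3.hasSum
    have hb := ha.nat_add_neg_add_one.tendsto_sum_nat
    have hc : Tendsto (fun N : ℕ => ∑ i ∈ Finset.range N,
      ((zG t n i - zG t n (i - 1)) / 2 + (zG t n (-(i + 1)) - zG t n (-(i + 1) - 1)) / 2)) atTop (𝓝 0) := by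
      have hsum : ∀ N : ℕ, ∑ i ∈ Finset.range N,
        ((zG t n i - zG t n (i - 1)) / 2 + (zG t n (-(i + 1)) - zG t n (-(i + 1) - 1)) / 2)
          = (zG t n (N - 1) - zG t n (-N - 1)) / 2 := by
        intro N
        have := Finset.sum_range_sub (fun k : ℕ => (zG t n ((k : ℤ) - 1) - zG t n (-(k : ℤ) - 1)) / 2) N
        simp only [Nat.cast_zero, neg_zero, sub_self, zero_div, sub_zero] at this
        rw [← this]
        refine Finset.sum_congr rfl fun k _ => ?_
        rw [show (((k + 1 : ℕ) : ℤ) - 1) = k by push_cast; ring,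
          show (-((k + 1 : ℕ) : ℤ) - 1) = -((k : ℤ) + 1) - 1 by push_cast; ring,
          show (-(k : ℤ) - 1) = -((k : ℤ) + 1) by ring]
        ring
      simp_rw [hsum]
      refine squeeze_zero_norm' (a := fun N : ℕ => 1 / (N : ℝ)) ?_ tendsto_one_div_atTop_nhds_zero_nat
      filter_upwards [eventually_ge_atTop 1] with N hN
      have hN' : (1 : ℝ) ≤ N := by exact_mod_cast hN
      have b1 := norm_zG_le ht n ((N : ℤ) - 1)
      have b2 := norm_zG_le ht n (-(N : ℤ) - 1)
      have c1 : 1 / |2 * (((N : ℤ) - 1 : ℤ) : ℝ) + 1| ≤ 1 / (N : ℝ) := by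
        push_cast
        apply one_div_le_one_div_of_le (by linarith)
        rw [abs_of_nonneg (by linarith)]; linarith
      have c2 : 1 / |2 * ((-(N : ℤ) - 1 : ℤ) : ℝ) + 1| ≤ 1 / (N : ℝ) := by
        push_cast
        apply one_div_le_one_div_of_le (by linarith)
        rw [abs_of_nonpos (by linarith)]; linarith
      rw [norm_div, show ‖(2 : ℂ)‖ = 2 by simp, div_le_iff₀ (by norm_num)]
      have := norm_sub_le (zG t n ((N : ℤ) - 1)) (zG t n (-(N : ℤ) - 1))
      linarith
    have := tendsto_nhds_unique hb hc
    rwa [this] at ha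
  have h5 := h4.add ((EisensteinSeries.e2Summand_summable n t).hasSum.mul_left (1 / 4))
  exact hasSum_conv h5 (fun m => zS_eq ht n m) (by rw [zero_add]; rfl)

lemma hasSum_zF_neg {t : UpperHalfPlane} (ht : (t : ℂ).re = 0) :
    HasSum (fun q => zF t (-q)) (∑' q, zF t q) := by
  have hF := (summable_zF ht).hasSum
  have h := (Equiv.hasSum_iff (f := zF t) (a := ∑' q, zF t q) (Equiv.neg (ℤ × ℤ))).mpr hF
  refine hasSum_conv h (fun q => ?_) (Eq.refl _)
  rw [Function.comp_apply, Equiv.neg_apply]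

lemma hasSum_one_ite :
    HasSum (fun q : ℤ × ℤ => if q = 0 then (1 : ℂ) else 0) 1 := by
  exact hasSum_ite_eq (0 : ℤ × ℤ) (1 : ℂ)

lemma hasSum_zS {t : UpperHalfPlane} (ht : (t : ℂ).re = 0) :
    HasSum (zS t) (1 + ∑' q, zF t q) := by
  have hF := (summable_zF ht).hasSum
  have := ((hF.add (hasSum_zF_neg ht)).div_const 2).add hasSum_one_ite
  refine hasSum_conv this (fun q => ?_) ?_
  · rw [zS]
  · ring

lemma hasSum_e2 {t : UpperHalfPlane} (ht : (t : ℂ).re = 0) :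
    HasSum (fun n => EisensteinSeries.e2Summand n t) (4 * (1 + ∑' q, zF t q)) := by
  have hS := hasSum_zS ht
  have h2 := (hS.prod_fiberwise (hasSum_fiber ht hS.summable)).mul_left 4
  exact hasSum_conv h2 (fun n => by ring) rfl

lemma G2_zF {t : UpperHalfPlane} (ht : (t : ℂ).re = 0) :
    EisensteinSeries.G2 t = 4 * (1 + ∑' q, zF t q) := by
  have h3 := hasSum_e2 ht
  rw [EisensteinSeries.G2, tsum_eq_of_summable_unconditional h3.summable, h3.tsum_eq]

lemma E2_G2 (t : UpperHalfPlane) :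
    EisensteinSeries.E2 t = 1 / (2 * riemannZeta 2) * EisensteinSeries.G2 t := rfl

lemma tsum_zF {t : UpperHalfPlane} (ht : (t : ℂ).re = 0) :
    1 + ∑' q, zF t q = Real.pi ^ 2 / 12 * EisensteinSeries.E2 t := by
  have hpi : (Real.pi : ℂ) ≠ 0 := by exact_mod_cast Real.pi_ne_zero
  rw [E2_G2, G2_zF ht, riemannZeta_two]
  generalize 1 + ∑' q, zF t q = S
  field_simp
  ring

lemma wzeta_pi {r : ℝ} (hr : 0 < r) :
    wzeta r (Real.pi : ℂ) = Real.pi / 12 * EisensteinSeries.E2 (tauPt r hr) := by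
  have hpi : (Real.pi : ℂ) ≠ 0 := by exact_mod_cast Real.pi_ne_zero
  have hcoe : ((tauPt r hr : UpperHalfPlane) : ℂ) = Complex.I * r / Real.pi := rfl
  have ht : ((tauPt r hr : UpperHalfPlane) : ℂ).re = 0 := by
    have e : (Complex.I * r / Real.pi : ℂ) = ((r / Real.pi : ℝ) : ℂ) * Complex.I := by
      push_cast; ring
    rw [hcoe, e]; simp
  have hterm : ∀ p : ℤ × ℤ, (if p = 0 then 0 else
      (1 / ((Real.pi : ℂ) - latPt r p) + 1 / latPt r p + (Real.pi : ℂ) / latPt r p ^ 2)) =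
      1 / Real.pi * zF (tauPt r hr) (Equiv.prodComm ℤ ℤ p) := by
    intro p
    by_cases hp : p = 0
    · simp [hp, zF]
    · have hp' : Equiv.prodComm ℤ ℤ p ≠ 0 := by
        intro h
        apply hp
        have h1 := congrArg Prod.fst h
        have h2 := congrArg Prod.snd h
        exact Prod.ext (by simpa using h2) (by simpa using h1)
      have e : latPt r p = 2 * Real.pi * uPt (tauPt r hr) (Equiv.prodComm ℤ ℤ p) := by
        rw [uPt, hcoe, latPt]
        simp
        field_simp
        ring
      have h0 := uPt_ne_zero (tauPt r hr) hp'
      have h1 := one_sub_ne ht (Equiv.prodComm ℤ ℤ p)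
      rw [if_neg hp, zF, if_neg hp', e]
      generalize uPt (tauPt r hr) (Equiv.prodComm ℤ ℤ p) = u at *
      have h2 : (Real.pi : ℂ) - 2 * Real.pi * u = Real.pi * (1 - 2 * u) := by ring
      rw [h2]
      field_simp
      ring
  rw [wzeta, tsum_congr hterm, tsum_mul_left, (Equiv.prodComm ℤ ℤ).tsum_eq]
  have := tsum_zF ht
  have e : ∑' q, zF (tauPt r hr) q = Real.pi ^ 2 / 12 * EisensteinSeries.E2 (tauPt r hr) - 1 := by
    rw [← this]; ring
  rw [e]
  field_simp
  ring

lemma hasDerivAt_re {f : ℝ → ℂ} {f' : ℂ} {s : ℝ} (h : HasDerivAt f f' s) :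
    HasDerivAt (fun s => (f s).re) f'.re s :=
  Complex.reCLM.hasFDerivAt.comp_hasDerivAt s h

lemma Theta_re_ne {r : ℝ} (hr : 0 < r) {x : ℝ} (hx : x ∈ Set.Ioo 0 (2 * Real.pi)) :
    (Tk 0 r x).re ≠ 0 := by
  intro h
  apply Theta_ne_zero hr hx
  rw [Theta_eq_Tk]
  exact Complex.ext h (Tk_real_im 0 r x)

lemma Tk_ofReal (k : ℕ) (r x : ℝ) : Tk k r x = (((Tk k r x).re : ℝ) : ℂ) :=
  Complex.ext rfl (by rw [Tk_real_im]; simp)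

lemma deriv_Theta {r : ℝ} (hr : 0 < r) : deriv (Theta r) = Tk 1 r := by
  funext z
  rw [Theta_eq_Tk]
  exact (hasDerivAt_Tk_z 0 hr z).deriv

lemma A_im {r : ℝ} (hr : 0 < r) : (deriv (Theta r) 0).im = 0 := by
  rw [deriv_Theta hr]
  simpa using Tk_real_im 1 r 0

lemma A_re_ne {r : ℝ} (hr : 0 < r) : (deriv (Theta r) 0).re ≠ 0 := by
  intro h
  exact deriv_Theta_zero_ne hr (Complex.ext h (A_im hr))

lemma hasDerivAt_A_re {r : ℝ} (hr : 0 < r) :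
    HasDerivAt (fun s : ℝ => (deriv (Theta s) 0).re)
      (-(1 / 4) * (EisensteinSeries.E2 (tauPt r hr)).re * (deriv (Theta r) 0).re) r := by
  refine (hasDerivAt_re (hasDerivAt_A hr)).congr_deriv ?_
  rw [Complex.mul_re, A_im hr, mul_zero, sub_zero]
  congr 1
  have e : (-(1 / 4) : ℂ) = ((-(1 / 4) : ℝ) : ℂ) := by push_cast; rfl
  rw [e, Complex.re_ofReal_mul]

lemma Zstar_eq (κ r x : ℝ) : Zstar κ r x =
    ((deriv (Theta r) 0).re) ^ ((2 : ℝ) / κ) * ((Tk 0 r (x : ℂ)).re) ^ (-((2 : ℝ) / κ)) := by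
  rw [Zstar, Theta_eq_Tk]

lemma hasDerivAt_Tk_x (k : ℕ) {r : ℝ} (hr : 0 < r) (x : ℝ) :
    HasDerivAt (fun y : ℝ => (Tk k r (y : ℂ)).re) (Tk (k + 1) r (x : ℂ)).re x :=
  (hasDerivAt_Tk_z k hr x).real_of_complex

lemma hasDerivAt_Zstar_x {κ r : ℝ} (hr : 0 < r) {x : ℝ} (hx : x ∈ Set.Ioo 0 (2 * Real.pi)) :
    HasDerivAt (Zstar κ r)
      (-(2 / κ) * ((Tk 1 r (x : ℂ)).re / (Tk 0 r (x : ℂ)).re) * Zstar κ r x) x := by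
  have hne := Theta_re_ne hr hx
  have h := ((hasDerivAt_Tk_x 0 hr x).rpow_const (p := -((2 : ℝ) / κ)) (Or.inl hne)).const_mul
    (((deriv (Theta r) 0).re) ^ ((2 : ℝ) / κ))
  have e : Zstar κ r = fun y : ℝ => ((deriv (Theta r) 0).re) ^ ((2 : ℝ) / κ) *
      ((Tk 0 r (y : ℂ)).re) ^ (-((2 : ℝ) / κ)) := funext fun y => Zstar_eq κ r y
  rw [e]
  refine h.congr_deriv ?_
  dsimp only
  rw [Real.rpow_sub_one hne]
  field_simp

open Filter Topology in
lemma deriv2_Zstar_x {κ r : ℝ} (hr : 0 < r) {x : ℝ} (hx : x ∈ Set.Ioo 0 (2 * Real.pi)) :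
    deriv (fun y => deriv (Zstar κ r) y) x =
      (-(2 / κ) * ((Tk 2 r (x : ℂ)).re / (Tk 0 r (x : ℂ)).re -
        ((Tk 1 r (x : ℂ)).re / (Tk 0 r (x : ℂ)).re) ^ 2) +
      (2 / κ) ^ 2 * ((Tk 1 r (x : ℂ)).re / (Tk 0 r (x : ℂ)).re) ^ 2) * Zstar κ r x := by
  have hne := Theta_re_ne hr hx
  have hev : (fun y => deriv (Zstar κ r) y) =ᶠ[𝓝 x]
      fun y => -(2 / κ) * ((Tk 1 r (y : ℂ)).re / (Tk 0 r (y : ℂ)).re) * Zstar κ r y := by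
    filter_upwards [isOpen_Ioo.mem_nhds hx] with y hy
    exact (hasDerivAt_Zstar_x hr hy).deriv
  rw [hev.deriv_eq]
  have h := ((((hasDerivAt_Tk_x 1 hr x).fun_div (hasDerivAt_Tk_x 0 hr x) hne).const_mul
    (-(2 / κ))).fun_mul (hasDerivAt_Zstar_x (κ := κ) hr hx))
  rw [h.deriv]
  simp only [Nat.reduceAdd, zero_add]
  field_simp

lemma hasDerivAt_Zstar_r {κ r : ℝ} (hr : 0 < r) {x : ℝ} (hx : x ∈ Set.Ioo 0 (2 * Real.pi)) :
    HasDerivAt (fun s => Zstar κ s x)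
      ((2 / κ) * (-(1 / 4) * (EisensteinSeries.E2 (tauPt r hr)).re -
        (Tk 2 r (x : ℂ)).re / (Tk 0 r (x : ℂ)).re) * Zstar κ r x) r := by
  have hne := Theta_re_ne hr hx
  have hA := A_re_ne hr
  have h0 : HasDerivAt (fun s : ℝ => (Tk 0 s (x : ℂ)).re) (Tk 2 r (x : ℂ)).re r :=
    hasDerivAt_re (hasDerivAt_Tk_r 0 hr x)
  have h := ((hasDerivAt_A_re hr).rpow_const (p := (2 : ℝ) / κ) (Or.inl hA)).fun_mul
    (h0.rpow_const (p := -((2 : ℝ) / κ)) (Or.inl hne))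
  have e : (fun s => Zstar κ s x) = fun s : ℝ => ((deriv (Theta s) 0).re) ^ ((2 : ℝ) / κ) *
      ((Tk 0 s (x : ℂ)).re) ^ (-((2 : ℝ) / κ)) := funext fun y => Zstar_eq κ y x
  rw [e]
  refine h.congr_deriv ?_
  rw [Real.rpow_sub_one hne, Real.rpow_sub_one hA, Zstar_eq]
  field_simp
  ring

lemma Hker_re {r : ℝ} (hr : 0 < r) (x : ℝ) :
    (Hker r (x : ℂ)).re = 2 * ((Tk 1 r (x : ℂ)).re / (Tk 0 r (x : ℂ)).re) := by
  rw [Hker, deriv_Theta hr, Theta_eq_Tk, Tk_ofReal 1, Tk_ofReal 0]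
  norm_cast
  ring

lemma deriv_Hker_re {r : ℝ} (hr : 0 < r) {x : ℝ} (hx : x ∈ Set.Ioo 0 (2 * Real.pi)) :
    (deriv (Hker r) (x : ℂ)).re = 2 * ((Tk 2 r (x : ℂ)).re / (Tk 0 r (x : ℂ)).re -
        ((Tk 1 r (x : ℂ)).re / (Tk 0 r (x : ℂ)).re) ^ 2) := by
  have hne := Theta_ne_zero hr hx
  rw [Theta_eq_Tk] at hne
  have e : Hker r = fun z => 2 * Tk 1 r z / Tk 0 r z := by
    funext z
    rw [Hker, deriv_Theta hr, Theta_eq_Tk]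
  have hne' := Theta_re_ne hr hx
  rw [e, (((hasDerivAt_Tk_z 1 hr x).const_mul 2).fun_div (hasDerivAt_Tk_z 0 hr x) hne).deriv]
  simp only [Nat.reduceAdd, zero_add]
  rw [Tk_ofReal 2, Tk_ofReal 1, Tk_ofReal 0]
  norm_cast
  field_simp

lemma wzeta_re {r : ℝ} (hr : 0 < r) :
    (wzeta r (Real.pi : ℂ)).re / Real.pi = (EisensteinSeries.E2 (tauPt r hr)).re / 12 := by
  rw [wzeta_pi hr]
  have e : ((Real.pi : ℂ) / 12) = ((Real.pi / 12 : ℝ) : ℂ) := by push_cast; rfl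
  rw [e, Complex.re_ofReal_mul]
  have := Real.pi_ne_zero
  field_simp


/-- Null-vector equation for the two-point partition function with charges
(a,−a), excursion-reflected boundary condition. -/
theorem null_vector_two_point (κ : ℝ) (hκ : 0 < κ)
    (r : ℝ) (hr : 0 < r) (x : ℝ) (hx : x ∈ Set.Ioo 0 (2 * Real.pi)) :
    deriv (fun s => Zstar κ s x) r =
      κ / 2 * deriv (fun y => deriv (Zstar κ r) y) x +
      (Hker r (x : ℂ)).re * deriv (Zstar κ r) x +
      (1 / 2 - 1 / κ) * (deriv (Hker r) (x : ℂ)).re * Zstar κ r x -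
      6 / κ * ((wzeta r (Real.pi : ℂ)).re / Real.pi) * Zstar κ r x := by
  rw [(hasDerivAt_Zstar_r hr hx).deriv, deriv2_Zstar_x hr hx, (hasDerivAt_Zstar_x hr hx).deriv,
    Hker_re hr, deriv_Hker_re hr hx, wzeta_re hr]
  have hne := Theta_re_ne hr hx
  field_simp
  ring
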